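/- arXiv:1305.0297 — 6 statements merged into one kernel-verified Lean document; each statement's English description precedes it below -/
import Mathlib

section
/- Let A, X, Y, Z, C, D, P be types, let f : X → C, g : Y → C, f' : Y → D, g' : Z → D be functions, and let u : C → P, v : D → P be functions with u ∘ g = v ∘ f' such that the commutative square with top-left Y, maps g : Y → C and f' : Y → D, and cocone maps u : C → P, v : D → P, is a pushout in the category of types. Then for every relation R ⊆ (X → A), one has T_{u∘f, v∘g'}(R) = T_{f',g'}(T_{f,g}(R)). (This is the statement that the relational algebra Rel_A respects the composition formula of the wiring-diagrams operad, where composition of wiring diagrams is given by pushout of cospans.) -/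
/-- The relation-transfer map associated to a cospan `X → C ← Y` of types:
`T f g R = { c ∘ g | c : C → A, c ∘ f ∈ R }`. -/
def relTransfer (A : Type) {X C Y : Type} (f : X → C) (g : Y → C)
    (R : Set (X → A)) : Set (Y → A) :=
  {s | ∃ c : C → A, c ∘ f ∈ R ∧ s = c ∘ g}

/-- The relational algebra `Rel_A` respects composition of wiring diagrams,
where composition of cospans is computed by pushout. -/
theorem relTransfer_comp_of_pushout (A X Y Z C D P : Type)
    (f : X → C) (g : Y → C) (f' : Y → D) (g' : Z → D)
    (u : C → P) (v : D → P)
    (hcomm : u ∘ g = v ∘ f')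
    (hpo : ∀ (W : Type) (α : C → W) (β : D → W), α ∘ g = β ∘ f' →
      ∃! h : P → W, h ∘ u = α ∧ h ∘ v = β) :
    ∀ R : Set (X → A),
      relTransfer A (u ∘ f) (v ∘ g') R =
        relTransfer A f' g' (relTransfer A f g R) := by
  intro R
  ext s
  constructor
  · rintro ⟨h, hR, rfl⟩
    exact ⟨h ∘ v, ⟨h ∘ u, hR, congrArg (h ∘ ·) hcomm.symm⟩, rfl⟩
  · rintro ⟨d, ⟨c, hR, hdc⟩, rfl⟩
    obtain ⟨h, ⟨rfl, rfl⟩, -⟩ := hpo A c d hdc.symm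
    exact ⟨h, hR, rfl⟩
end

section
/- Let A be a type having at least two distinct elements, and let N be an additive commutative monoid. Suppose given, for every finite type X, a function p_X : Set (X → A) → N, and suppose p is natural with respect to all wiring diagrams: for every n : ℕ, every family of finite types X : Fin n → Type, all finite types C and Y, all functions f : (Σ i, X i) → C and g : Y → C, and all relations R i ⊆ (X i → A), one has p_Y(Rel_A(f,g)(R)) = ∑ i, p_{X i}(R i). Then p is trivial: p_X(R) = 0 for every finite type X and every relation R ⊆ (X → A). -/
/-- The φ-conjunction of relations `R i ⊆ (X i → A)` along the wiring diagram
given by the cospan `(Σ i, X i) → C ← Y`. -/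
def phiConj (A : Type) {n : ℕ} {X : Fin n → Type} {C Y : Type}
    (f : (Σ i, X i) → C) (g : Y → C) (R : ∀ i, Set (X i → A)) : Set (Y → A) :=
  {s | ∃ c : C → A, (∀ i, (fun x => c (f ⟨i, x⟩)) ∈ R i) ∧ s = c ∘ g}

theorem phiConj_empty_eq_univ {A : Type} {n : ℕ} {X : Fin n → Type} {C : Type}
    (f : (Σ i, X i) → C) (g : Empty → C) (R : ∀ i, Set (X i → A))
    (c : C → A) (hc : ∀ i, (fun x => c (f ⟨i, x⟩)) ∈ R i) :
    phiConj A f g R = Set.univ :=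
  Set.eq_univ_of_forall fun _ => ⟨c, hc, Subsingleton.elim _ _⟩

/-- If `|A| ≥ 2`, the only additive-monoid-valued invariant of relations that is
natural with respect to all wiring diagrams is trivial. -/
theorem no_additive_invariant (A : Type) (a₁ a₂ : A) (hA : a₁ ≠ a₂)
    (N : Type) [AddCommMonoid N]
    (p : ∀ (X : Type), Fintype X → Set (X → A) → N)
    (hnat : ∀ (n : ℕ) (X : Fin n → Type) (iX : ∀ i, Fintype (X i))
      (C Y : Type) (_ : Fintype C) (iY : Fintype Y)
      (f : (Σ i, X i) → C) (g : Y → C) (R : ∀ i, Set (X i → A)),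
      p Y iY (phiConj A f g R) = ∑ i, p (X i) (iX i) (R i)) :
    ∀ (X : Type) (iX : Fintype X) (R : Set (X → A)), p X iX R = 0 := by
  have h_univ : p Empty inferInstance Set.univ = 0 := by
    have h := hnat 0 (fun _ => Empty) (fun _ => inferInstance) Empty Empty inferInstance
      inferInstance Sigma.snd id (fun _ => Set.univ)
    rwa [phiConj_empty_eq_univ _ _ _ Empty.elim fun i => i.elim0, Fin.sum_univ_zero] at h
  have h_hide (X : Type) (iX : Fintype X) (R : Set (X → A)) :
      p Empty inferInstance (phiConj A (n := 1) Sigma.snd Empty.elim fun _ => R) = p X iX R := by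
    simpa using hnat 1 (fun _ => X) (fun _ => iX) X Empty iX inferInstance
      Sigma.snd Empty.elim (fun _ => R)
  have h_nonempty (X : Type) (iX : Fintype X) (R : Set (X → A)) (hR : R.Nonempty) :
      p X iX R = 0 := by
    obtain ⟨r, hr⟩ := hR
    rw [← h_hide X iX R, phiConj_empty_eq_univ _ _ _ r fun _ => hr, h_univ]
  have h_empty : p Empty inferInstance ∅ = 0 := by
    have h := hnat 2 (fun _ => Unit) (fun _ => inferInstance) Unit Empty inferInstance
      inferInstance Sigma.snd Empty.elim ![{fun _ => a₁}, {fun _ => a₂}]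
    have h_conj : phiConj A (n := 2) (X := fun _ => Unit) Sigma.snd Empty.elim
        ![{fun _ => a₁}, {fun _ => a₂}] = ∅ := by
      refine Set.eq_empty_of_forall_notMem ?_
      rintro _ ⟨c, hc, -⟩
      exact hA ((congrFun (hc 0) ()).symm.trans (congrFun (hc 1) ()))
    rw [h_conj, Fin.sum_univ_two] at h
    rw [h, h_nonempty _ _ (![{fun _ => a₁}, {fun _ => a₂}] 0) (Set.singleton_nonempty _),
      h_nonempty _ _ (![{fun _ => a₁}, {fun _ => a₂}] 1) (Set.singleton_nonempty _), add_zero]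
  intro X iX R
  rcases R.eq_empty_or_nonempty with rfl | hR
  · have h_conj : phiConj A (n := 1) (X := fun _ => X) Sigma.snd Empty.elim (fun _ => ∅) = ∅ :=
      Set.eq_empty_of_forall_notMem fun _ ⟨_, hc, _⟩ => hc 0
    rw [← h_hide X iX ∅, h_conj, h_empty]
  · exact h_nonempty X iX R hR
end

section
/- Let A be a type and let N be an additive commutative monoid. Suppose given, for every finite type X, a function p_X : Set (X → A) → N which is natural with respect to all wiring diagrams: for every n : ℕ, every family of finite types X : Fin n → Type, all finite types C and Y, all functions f : (Σ i, X i) → C and g : Y → C, and all relations R i ⊆ (X i → A), one has p_Y(Rel_A(f,g)(R)) = ∑ i, p_{X i}(R i). Then for every finite type X and every nonempty relation R ⊆ (X → A), one has p_X(R) = 0. -/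
/-- Any additive-monoid-valued invariant of relations that is natural with
respect to all wiring diagrams sends every nonempty relation to zero. -/
theorem additive_invariant_nonempty (A : Type) (N : Type) [AddCommMonoid N]
    (p : ∀ (X : Type), Fintype X → Set (X → A) → N)
    (hnat : ∀ (n : ℕ) (X : Fin n → Type) (iX : ∀ i, Fintype (X i))
      (C Y : Type) (_ : Fintype C) (iY : Fintype Y)
      (f : (Σ i, X i) → C) (g : Y → C) (R : ∀ i, Set (X i → A)),
      p Y iY (phiConj A f g R) = ∑ i, p (X i) (iX i) (R i)) :
    ∀ (X : Type) (iX : Fintype X) (R : Set (X → A)), R.Nonempty →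
      p X iX R = 0 := by
  intro X iX R hR
  obtain ⟨r, hr⟩ := hR
  have h0 := hnat 0 (fun _ => Empty) (fun _ => inferInstance) Empty Empty inferInstance
    inferInstance (fun x => x.1.elim0) id (fun _ => Set.univ)
  have h1 := hnat 1 (fun _ => X) (fun _ => iX) X Empty iX inferInstance
    (fun x => x.2) Empty.elim (fun _ => R)
  have e0 : phiConj A (fun x : (Σ _ : Fin 0, Empty) => (x.1.elim0 : Empty)) id
      (fun _ => Set.univ) = Set.univ :=
    Set.eq_univ_of_forall fun s => ⟨s, fun i => i.elim0, rfl⟩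
  have e1 : phiConj A (fun x : (Σ _ : Fin 1, X) => x.2) Empty.elim (fun _ => R) = Set.univ :=
    Set.eq_univ_of_forall fun s => ⟨r, fun _ => hr, Subsingleton.elim _ _⟩
  rw [e0, Fin.sum_univ_zero] at h0
  rw [e1, Fin.sum_univ_one, h0] at h1
  exact h1.symm
end

section
/- Let X, Y, Z, C, D, P be types, let f : X → C, g : Y → C, f' : Y → D, g' : Z → D be functions, and let u : C → P, v : D → P be functions with u ∘ g = v ∘ f' such that the commutative square with top-left Y, maps g : Y → C and f' : Y → D, and cocone maps u : C → P, v : D → P, is a pushout in the category of types. Then for every setoid s on X, one has E_{u∘f, v∘g'}(s) = E_{f',g'}(E_{f,g}(s)) as setoids on Z. (This is the statement that the equivalence-relations construction Eq respects the composition formula of the wiring-diagrams operad, where composition of wiring diagrams is given by pushout of cospans.) -/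
/-- The equivalence relation on the outer star `Y` induced by an equivalence
relation `s` on the inner star `X` via the wiring diagram given by the cospan
`X → C ← Y`. -/
def eqTransfer {X C Y : Type} (f : X → C) (g : Y → C) (s : Setoid X) :
    Setoid Y :=
  Setoid.comap g (Relation.EqvGen.setoid
    (fun c c' => ∃ x x' : X, s.r x x' ∧ f x = c ∧ f x' = c'))

/-- The equivalence relation on the cables of the cospan `X → C ← Y` generated by the image of an
equivalence relation on `X`. -/
def cableSetoid {X C : Type} (f : X → C) (s : Setoid X) : Setoid C :=
  Relation.EqvGen.setoid (fun c c' => ∃ x x' : X, s.r x x' ∧ f x = c ∧ f x' = c')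

theorem cableSetoid_apply {X C : Type} (f : X → C) {s : Setoid X} {x x' : X} (h : s x x') :
    cableSetoid f s (f x) (f x') :=
  .rel _ _ ⟨x, x', h, rfl, rfl⟩

theorem cableSetoid_le {X C : Type} {f : X → C} {s : Setoid X} {t : Setoid C}
    (h : ∀ x x', s x x' → t (f x) (f x')) : cableSetoid f s ≤ t := by
  refine Setoid.eqvGen_le ?_
  rintro _ _ ⟨x, x', hs, rfl, rfl⟩
  exact h x x' hs

theorem eqTransfer_eq_comap {X C Y : Type} (f : X → C) (g : Y → C) (s : Setoid X) :
    eqTransfer f g s = (cableSetoid f s).comap g :=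
  rfl

/-- The equivalence relations generated on a pushout `P` of `C ← Y → D` and on `D` agree along
`D → P`: a class in `D` extends to a subset of `P` saturated for the relation on `P`. -/
theorem comap_cableSetoid_of_pushout {X Y C D P : Type}
    {f : X → C} {g : Y → C} {f' : Y → D} {u : C → P} {v : D → P}
    (hcomm : u ∘ g = v ∘ f')
    (hpo : ∀ (W : Type) (α : C → W) (β : D → W), α ∘ g = β ∘ f' →
      ∃! h : P → W, h ∘ u = α ∧ h ∘ v = β) (s : Setoid X) :
    (cableSetoid (u ∘ f) s).comap v = cableSetoid f' (eqTransfer f g s) := by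
  set R := cableSetoid f s
  set T := cableSetoid f' (eqTransfer f g s)
  apply le_antisymm
  · intro d e hd
    obtain ⟨h, ⟨hu, hv⟩, -⟩ := hpo Prop (fun c => ∃ y, R (g y) c ∧ T d (f' y)) (T d) (by
      funext y
      refine propext ⟨?_, fun hy => ⟨y, R.refl _, hy⟩⟩
      rintro ⟨y', hR, hT⟩
      exact T.trans hT (cableSetoid_apply f' hR))
    have hsat : cableSetoid (u ∘ f) s ≤ Setoid.ker h := cableSetoid_le fun x x' hx => by
      have hR : R (f x) (f x') := cableSetoid_apply f hx
      change (h ∘ u) (f x) = (h ∘ u) (f x')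
      rw [hu]
      exact propext ⟨fun ⟨y, hy, hT⟩ => ⟨y, R.trans hy hR, hT⟩,
        fun ⟨y, hy, hT⟩ => ⟨y, R.trans hy (R.symm hR), hT⟩⟩
    have heq : (h ∘ v) d = (h ∘ v) e := hsat hd
    rw [hv] at heq
    exact heq.mp (T.refl d)
  · refine cableSetoid_le fun y y' hy => ?_
    have hle : R ≤ (cableSetoid (u ∘ f) s).comap u :=
      cableSetoid_le fun x x' hx => cableSetoid_apply (u ∘ f) hx
    change cableSetoid (u ∘ f) s ((v ∘ f') y) ((v ∘ f') y')
    rw [← hcomm]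
    exact hle hy

/-- The equivalence-relations construction respects composition of wiring
diagrams, where composition of cospans is computed by pushout. -/
theorem eqTransfer_comp_of_pushout (X Y Z C D P : Type)
    (f : X → C) (g : Y → C) (f' : Y → D) (g' : Z → D)
    (u : C → P) (v : D → P)
    (hcomm : u ∘ g = v ∘ f')
    (hpo : ∀ (W : Type) (α : C → W) (β : D → W), α ∘ g = β ∘ f' →
      ∃! h : P → W, h ∘ u = α ∧ h ∘ v = β) :
    ∀ s : Setoid X,
      eqTransfer (u ∘ f) (v ∘ g') s = eqTransfer f' g' (eqTransfer f g s) := by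
  intro s
  rw [eqTransfer_eq_comap f' g', ← comap_cableSetoid_of_pushout hcomm hpo]
  rfl
end

section
/- Let Y, Z, C be types and let g : Y ⊕ Z → C be a function. Define fold : (Y ⊕ Z) ⊕ Y → Y ⊕ Z as Sum.elim id Sum.inl, define h : (Y ⊕ Z) ⊕ Y → C ⊕ Y as Sum.map g id, and define m : C ⊕ Y → C as Sum.elim id (g ∘ Sum.inl). Then m ∘ h = g ∘ fold, and the resulting commutative square — with corner (Y ⊕ Z) ⊕ Y, top map fold into Y ⊕ Z, left map h into C ⊕ Y, right map g into C, and bottom map m into C — is a pushout in the category of types. (This pushout computation is the key step in showing that composing a wiring diagram X → [Y ⇒ Z] with the evaluation wiring diagram yields the externalized wiring diagram (X, Y) → Z, establishing that the wiring-diagrams operad is closed with internal Hom-object [Y ⇒ Z] = Y ⊕ Z.) -/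
/-- Composing a wiring diagram into `[Y ⇒ Z] = Y ⊕ Z` with the evaluation
wiring diagram: the square with corner `(Y ⊕ Z) ⊕ Y`, top map the fold map
into `Y ⊕ Z`, left map `Sum.map g id` into `C ⊕ Y`, right map `g` into `C`,
and bottom map `Sum.elim id (g ∘ Sum.inl)` into `C`, commutes and is a pushout
in the category of types. -/
theorem eval_pushout (Y Z C : Type) (g : Y ⊕ Z → C) :
    let fold : (Y ⊕ Z) ⊕ Y → Y ⊕ Z := Sum.elim id Sum.inl
    let h : (Y ⊕ Z) ⊕ Y → C ⊕ Y := Sum.map g id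
    let m : C ⊕ Y → C := Sum.elim id (g ∘ Sum.inl)
    m ∘ h = g ∘ fold ∧
      ∀ (W : Type) (α : Y ⊕ Z → W) (β : C ⊕ Y → W), α ∘ fold = β ∘ h →
        ∃! t : C → W, t ∘ g = α ∧ t ∘ m = β := by
  intro fold h m
  refine ⟨?_, fun W α β hαβ => ?_⟩
  · funext x
    rcases x with x | y <;> rfl
  · have hα : ∀ x, α x = β (Sum.inl (g x)) := fun x => congrFun hαβ (Sum.inl x)
    have hβ : ∀ y, α (Sum.inl y) = β (Sum.inr y) := fun y => congrFun hαβ (Sum.inr y)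
    refine ⟨β ∘ Sum.inl, ⟨funext fun x => (hα x).symm, funext fun x => ?_⟩, fun t ht => ?_⟩
    · rcases x with c | y
      · rfl
      · exact (hα (Sum.inl y)).symm.trans (hβ y)
    · exact funext fun c => congrFun ht.2 (Sum.inl c)
end

section
/- Let q : Set (ℕ × ℕ) → Set (ℕ × ℕ) be defined by q F = { (a, b) | ∃ b', (a - 1, b') ∈ F ∧ b = if a = 0 then 1 else a * b' }, where a - 1 denotes truncated subtraction on ℕ. If F ⊆ ℕ × ℕ is nonempty and satisfies F = q F, then F equals the graph of the factorial function: F = { (a, b) | b = a ! }. In other words, the factorial relation is the unique nonempty fixed point of this recursive setup. -/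
/-- The function on binary relations on `ℕ` induced by the recursive setup for
the factorial: decrement the input, look up the relation, multiply, and handle
the base case. -/
def factStep (F : Set (ℕ × ℕ)) : Set (ℕ × ℕ) :=
  {p | ∃ b', (p.1 - 1, b') ∈ F ∧ p.2 = if p.1 = 0 then 1 else p.1 * b'}

theorem mem_factStep {F : Set (ℕ × ℕ)} {a b : ℕ} :
    (a, b) ∈ factStep F ↔ ∃ b', (a - 1, b') ∈ F ∧ b = if a = 0 then 1 else a * b' :=
  Iff.rfl

/-- Following the recursion downwards, a fixed point related to some input is
related to the input `0`. -/
theorem exists_zero_mem_of_mem {F : Set (ℕ × ℕ)} (hfix : F = factStep F) (a : ℕ) :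
    ∀ b, (a, b) ∈ F → ∃ b', (0, b') ∈ F := by
  induction a with
  | zero => exact fun b hb => ⟨b, hb⟩
  | succ n ih =>
    intro b hb
    rw [hfix, mem_factStep] at hb
    obtain ⟨b', hb', -⟩ := hb
    exact ih b' hb'

/-- The graph of the factorial function is the unique nonempty fixed point of
the recursive setup for the factorial. -/
theorem factorial_unique_fixed_point (F : Set (ℕ × ℕ)) (hne : F.Nonempty)
    (hfix : F = factStep F) : F = {p : ℕ × ℕ | p.2 = Nat.factorial p.1} := by
  obtain ⟨⟨a₀, b₀⟩, h₀⟩ := hne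
  obtain ⟨c, hc⟩ := exists_zero_mem_of_mem hfix a₀ b₀ h₀
  have key : ∀ a b, (a, b) ∈ F ↔ b = Nat.factorial a := by
    intro a
    induction a with
    | zero =>
      intro b
      rw [hfix, mem_factStep]
      exact ⟨fun ⟨_, _, h⟩ => by simpa using h, fun h => ⟨c, hc, by simpa using h⟩⟩
    | succ n ih =>
      intro b
      rw [hfix, mem_factStep]
      simp [ih, Nat.factorial_succ]
  ext ⟨a, b⟩
  exact key a b
end
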